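/- There exists a constant C > 0 with the following property: for every integer D ≥ 3, every finite set A ⊆ {0, 1, …, D}, and every Λ ⊆ ℤ with A ⊕ Λ = ℤ a tiling at level 1, the set Λ has a period t with 1 ≤ t ≤ exp(C · √D · log D · √(log log D)), i.e. Λ + t = Λ. -/

import Mathlib

lemma aux_prod_ge (s : Finset ℕ) (hs : ∀ p ∈ s, 2 ≤ p) :
    (1 / 2 : ℝ) ≤ ∏ p ∈ s, (1 - ((p : ℝ) ^ 2)⁻¹) := by
  have h1 : ∀ N : ℕ, 2 ≤ N →
      (1 / 2 + 1 / (2 * N) : ℝ) ≤ ∏ p ∈ Finset.Ico 2 (N + 1), (1 - ((p : ℝ) ^ 2)⁻¹) := by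
    intro N hN
    induction N, hN using Nat.le_induction with
    | base => norm_num
    | succ n hn ih =>
      rw [Finset.prod_Ico_succ_top (by omega)]
      have hn' : (2 : ℝ) ≤ n := by exact_mod_cast hn
      have h0 : (0 : ℝ) ≤ 1 - (((n + 1 : ℕ) : ℝ) ^ 2)⁻¹ := by
        rw [sub_nonneg]
        apply inv_le_one_of_one_le₀
        push_cast
        nlinarith
      refine le_trans (le_of_eq ?_) (mul_le_mul_of_nonneg_right ih h0)
      push_cast
      field_simp
      ring
  obtain ⟨N, hN2, hN⟩ : ∃ N : ℕ, 2 ≤ N ∧ s ⊆ Finset.Ico 2 (N + 1) := by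
    refine ⟨s.sup id + 2, by omega, fun p hp => ?_⟩
    have := Finset.le_sup (f := id) hp
    have := hs p hp
    simp only [Finset.mem_Ico, id] at *
    omega
  have hle : ∀ p : ℕ, 2 ≤ p → 0 ≤ (1 - ((p : ℝ) ^ 2)⁻¹) ∧ (1 - ((p : ℝ) ^ 2)⁻¹) ≤ 1 := by
    intro p hp
    have hn' : (2 : ℝ) ≤ p := by exact_mod_cast hp
    constructor
    · rw [sub_nonneg]
      apply inv_le_one_of_one_le₀
      nlinarith
    · have : 0 ≤ ((p : ℝ) ^ 2)⁻¹ := by positivity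
      linarith
  have h2 := h1 N hN2
  rw [← Finset.prod_sdiff hN] at h2
  have h3 : ∏ p ∈ Finset.Ico 2 (N + 1) \ s, (1 - ((p : ℝ) ^ 2)⁻¹) ≤ 1 := by
    apply Finset.prod_le_one
    · intro i hi
      exact (hle i (by simp at hi; omega)).1
    · intro i hi
      exact (hle i (by simp at hi; omega)).2
  have h4 : 0 ≤ ∏ p ∈ s, (1 - ((p : ℝ) ^ 2)⁻¹) :=
    Finset.prod_nonneg fun i hi => (hle i (hs i hi)).1
  have h5 : (0 : ℝ) ≤ 1 / (2 * N) := by positivity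
  nlinarith [mul_le_mul_of_nonneg_right h3 h4]

lemma aux_tot (n : ℕ) (hn : 0 < n) :
    (n : ℝ) ≤ 2 * (n.totient : ℝ) * ∑ d ∈ n.divisors, (d : ℝ)⁻¹ := by
  have h1 : (n.totient : ℝ) = n * ∏ p ∈ n.primeFactors, (1 - (p : ℝ)⁻¹) := by
    have := Nat.totient_eq_mul_prod_factors n
    have h2 := congrArg (fun q : ℚ => (q : ℝ)) this
    push_cast at h2
    exact h2
  have h2 : ∏ p ∈ n.primeFactors, (1 + (p : ℝ)⁻¹) ≤ ∑ d ∈ n.divisors, (d : ℝ)⁻¹ := by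
    rw [Finset.prod_one_add]
    have hinj : Set.InjOn (fun t : Finset ℕ => ∏ p ∈ t, p) (n.primeFactors.powerset : Set (Finset ℕ)) := by
      intro t ht u hu h
      simp only [Finset.coe_powerset, Set.mem_preimage, Set.mem_powerset_iff, Finset.coe_subset] at ht hu
      rw [← Nat.primeFactors_prod (s := t) (fun p hp => Nat.prime_of_mem_primeFactors (ht hp)),
        ← Nat.primeFactors_prod (s := u) (fun p hp => Nat.prime_of_mem_primeFactors (hu hp))]
      exact congrArg _ h
    have : ∑ t ∈ n.primeFactors.powerset, ∏ i ∈ t, (i : ℝ)⁻¹ =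
        ∑ d ∈ n.primeFactors.powerset.image (fun t : Finset ℕ => ∏ p ∈ t, p), (d : ℝ)⁻¹ := by
      rw [Finset.sum_image hinj]
      apply Finset.sum_congr rfl
      intro t _
      push_cast
      rw [Finset.prod_inv_distrib]
    rw [this]
    apply Finset.sum_le_sum_of_subset_of_nonneg
    · intro d hd
      simp only [Finset.mem_image, Finset.mem_powerset] at hd
      obtain ⟨t, ht, rfl⟩ := hd
      rw [Nat.mem_divisors]
      exact ⟨(Finset.prod_dvd_prod_of_subset _ _ _ ht).trans (Nat.prod_primeFactors_dvd n), hn.ne'⟩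
    · intros; positivity
  have h3 := aux_prod_ge n.primeFactors (fun p hp => (Nat.prime_of_mem_primeFactors hp).two_le)
  have h4 : ∏ p ∈ n.primeFactors, (1 - ((p : ℝ) ^ 2)⁻¹) =
      (∏ p ∈ n.primeFactors, (1 - (p : ℝ)⁻¹)) * ∏ p ∈ n.primeFactors, (1 + (p : ℝ)⁻¹) := by
    rw [← Finset.prod_mul_distrib]
    apply Finset.prod_congr rfl
    intro p _
    rw [← inv_pow]; ring
  have h5 : (0 : ℝ) ≤ n.totient := by positivity
  have hn0 : (0 : ℝ) ≤ n := by positivity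
  calc (n : ℝ) ≤ 2 * (n * ∏ p ∈ n.primeFactors, (1 - ((p : ℝ) ^ 2)⁻¹)) := by nlinarith
    _ = 2 * (n.totient : ℝ) * ∏ p ∈ n.primeFactors, (1 + (p : ℝ)⁻¹) := by rw [h4, h1]; ring
    _ ≤ _ := by gcongr

lemma aux_sq (n : ℕ) (hn : 0 < n) : (n : ℝ) ≤ 16 * (n.totient : ℝ) ^ 2 := by
  have h1 := aux_tot n hn
  have h2 : ∑ d ∈ n.divisors, (d : ℝ)⁻¹ ≤ 1 + Real.log n := by
    have := harmonic_le_one_add_log n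
    rw [harmonic_eq_sum_Icc] at this
    push_cast at this
    refine le_trans ?_ this
    apply Finset.sum_le_sum_of_subset_of_nonneg
    · intro d hd
      have := Nat.divisor_le hd
      have := Nat.pos_of_mem_divisors hd
      simp; omega
    · intros; positivity
  have hn1 : (1 : ℝ) ≤ n := by exact_mod_cast hn
  have h3 : 1 + Real.log n ≤ 2 * √n := by
    have h := Real.log_le_sub_one_of_pos (x := √n) (by positivity)
    rw [Real.log_sqrt (by positivity)] at h
    linarith
  have hs : √(n : ℝ) * √n = n := Real.mul_self_sqrt (by positivity)
  have hs1 : 0 < √(n : ℝ) := by positivity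
  have ht : (0 : ℝ) ≤ n.totient := by positivity
  have h4 : (n : ℝ) ≤ 2 * n.totient * (2 * √n) :=
    h1.trans (by gcongr; linarith)
  have h5 : √(n : ℝ) ≤ 4 * n.totient := by nlinarith
  nlinarith

lemma aux_K : ∃ K : ℝ, 0 < K ∧ ∀ s : Finset ℕ, ∑ d ∈ s, ((d : ℝ) * √d)⁻¹ ≤ K := by
  have hsum : Summable fun d : ℕ => ((d : ℝ) * √d)⁻¹ := by
    have := (Real.summable_nat_rpow_inv (p := 3 / 2)).2 (by norm_num)
    refine this.congr fun d => ?_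
    rcases Nat.eq_zero_or_pos d with rfl | hd
    · simp
    · rw [Real.sqrt_eq_rpow, ← Real.rpow_one_add' (by positivity) (by norm_num)]
      norm_num
  refine ⟨(∑' d : ℕ, ((d : ℝ) * √d)⁻¹) + 1, ?_, fun s => ?_⟩
  · have : 0 ≤ ∑' d : ℕ, ((d : ℝ) * √d)⁻¹ := tsum_nonneg fun d => by positivity
    linarith
  · have := hsum.sum_le_tsum s (fun d _ => by positivity)
    linarith

lemma aux_tail (m N d : ℕ) (hd : 0 < d) :
    ∑ n ∈ (Finset.Ioo m N).filter (fun n => d ∣ n), ((n : ℝ) ^ 2)⁻¹ ≤ 2 / (d * (m + 1)) := by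
  have h1 : ∑ n ∈ (Finset.Ioo m N).filter (fun n => d ∣ n), ((n : ℝ) ^ 2)⁻¹ ≤
      ∑ n ∈ (Finset.Ioo (m / d) N).image (fun j => d * j), ((n : ℝ) ^ 2)⁻¹ := by
    apply Finset.sum_le_sum_of_subset_of_nonneg
    · intro n hn
      simp only [Finset.mem_filter, Finset.mem_Ioo] at hn
      obtain ⟨⟨h1, h2⟩, j, rfl⟩ := hn
      simp only [Finset.mem_image, Finset.mem_Ioo]
      refine ⟨j, ⟨?_, ?_⟩, rfl⟩
      · rw [Nat.div_lt_iff_lt_mul hd]; linarith [mul_comm d j]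
      · nlinarith
    · intros; positivity
  rw [Finset.sum_image (by intro a _ b _ h; exact Nat.eq_of_mul_eq_mul_left hd h)] at h1
  refine h1.trans ?_
  have h2 := sum_Ioo_inv_sq_le (α := ℝ) (m / d) N
  have hd' : (0 : ℝ) < d := by exact_mod_cast hd
  have h3 : ∑ j ∈ Finset.Ioo (m / d) N, (((d * j : ℕ) : ℝ) ^ 2)⁻¹ =
      ((d : ℝ) ^ 2)⁻¹ * ∑ j ∈ Finset.Ioo (m / d) N, ((j : ℝ) ^ 2)⁻¹ := by
    rw [Finset.mul_sum]
    apply Finset.sum_congr rfl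
    intro j _
    push_cast
    rw [mul_pow, mul_inv]
  rw [h3]
  have h4 : ((m : ℝ) + 1) ≤ d * (((m / d : ℕ) : ℝ) + 1) := by
    have := Nat.lt_mul_div_succ m hd
    have : m + 1 ≤ d * (m / d + 1) := this
    exact_mod_cast this
  calc ((d : ℝ) ^ 2)⁻¹ * ∑ j ∈ Finset.Ioo (m / d) N, ((j : ℝ) ^ 2)⁻¹
      ≤ ((d : ℝ) ^ 2)⁻¹ * (2 / (((m / d : ℕ) : ℝ) + 1)) := by gcongr
    _ = 2 / (d * (d * (((m / d : ℕ) : ℝ) + 1))) := by field_simp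
    _ ≤ _ := by gcongr

lemma aux_count : ∃ C : ℝ, 0 < C ∧ ∀ (x : ℝ) (S : Finset ℕ), 1 ≤ x →
    (∀ n ∈ S, 0 < n ∧ (n.totient : ℝ) ≤ x) → (S.card : ℝ) ≤ C * x := by
  obtain ⟨K, hK, hKs⟩ := aux_K
  refine ⟨1 + 8 * K ^ 2, by positivity, fun x S hx hS => ?_⟩
  set m := ⌊x⌋₊ with hm
  have hmx : (m : ℝ) ≤ x := Nat.floor_le (by linarith)
  have hmx' : x < m + 1 := Nat.lt_floor_add_one x
  set N := S.sup id + 1 with hN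
  have hcard := Finset.card_filter_add_card_filter_not (s := S) (fun n => n ≤ m)
  have h1 : (S.filter (fun n => n ≤ m)).card ≤ m := by
    have : S.filter (fun n => n ≤ m) ⊆ Finset.Icc 1 m := by
      intro n hn
      simp only [Finset.mem_filter] at hn
      have := (hS n hn.1).1
      simp; omega
    simpa using Finset.card_le_card this
  have hsub : S.filter (fun n => ¬ n ≤ m) ⊆ Finset.Ioo m N := by
    intro n hn
    simp only [Finset.mem_filter] at hn
    have := Finset.le_sup (f := id) hn.1
    simp only [Finset.mem_Ioo, id] at *
    omega
  have h2 : ∀ n ∈ S, 1 ≤ 4 * K * x ^ 2 * (∑ d ∈ n.divisors, (√(d : ℝ))⁻¹ * ((n : ℝ) ^ 2)⁻¹) := by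
    intro n hn
    obtain ⟨hn0, hnx⟩ := hS n hn
    have ha := aux_tot n hn0
    have hcs : (∑ d ∈ n.divisors, (d : ℝ)⁻¹) ^ 2 ≤
        (∑ d ∈ n.divisors, ((d : ℝ) * √d)⁻¹) * ∑ d ∈ n.divisors, (√(d : ℝ))⁻¹ := by
      apply Finset.sum_sq_le_sum_mul_sum_of_sq_le_mul
      · intros; positivity
      · intros; positivity
      · intro d _
        apply le_of_eq
        rw [← mul_inv, mul_assoc, Real.mul_self_sqrt (by positivity), inv_pow, sq]
    have hnp : (0 : ℝ) < n := by exact_mod_cast hn0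
    rw [← Finset.sum_mul, ← mul_assoc, ← div_eq_mul_inv, le_div_iff₀ (by positivity), one_mul]
    have hg : 0 ≤ ∑ d ∈ n.divisors, (√(d : ℝ))⁻¹ := Finset.sum_nonneg fun _ _ => by positivity
    have hg' : 0 ≤ ∑ d ∈ n.divisors, (d : ℝ)⁻¹ := Finset.sum_nonneg fun _ _ => by positivity
    calc (n : ℝ) ^ 2 ≤ (2 * (n.totient : ℝ) * ∑ d ∈ n.divisors, (d : ℝ)⁻¹) ^ 2 := by gcongr
      _ = 4 * (n.totient : ℝ) ^ 2 * (∑ d ∈ n.divisors, (d : ℝ)⁻¹) ^ 2 := by ring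
      _ ≤ 4 * x ^ 2 * (K * ∑ d ∈ n.divisors, (√(d : ℝ))⁻¹) := by
        gcongr
        exact hcs.trans (mul_le_mul_of_nonneg_right (hKs _) hg)
      _ = _ := by ring
  have h3 : ∑ n ∈ Finset.Ioo m N, ∑ d ∈ n.divisors, (√(d : ℝ))⁻¹ * ((n : ℝ) ^ 2)⁻¹ ≤ 2 * K / x := by
    have e : ∑ n ∈ Finset.Ioo m N, ∑ d ∈ n.divisors, (√(d : ℝ))⁻¹ * ((n : ℝ) ^ 2)⁻¹ =
        ∑ d ∈ Finset.Ioo 0 N, ∑ n ∈ (Finset.Ioo m N).filter (fun n => d ∣ n),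
          (√(d : ℝ))⁻¹ * ((n : ℝ) ^ 2)⁻¹ := by
      apply Finset.sum_comm'
      intro n d
      simp only [Finset.mem_Ioo, Nat.mem_divisors, Finset.mem_filter]
      constructor
      · rintro ⟨⟨a, b⟩, c, e⟩
        exact ⟨⟨⟨a, b⟩, c⟩, Nat.pos_of_dvd_of_pos c (by omega), (Nat.le_of_dvd (by omega) c).trans_lt b⟩
      · rintro ⟨⟨⟨a, b⟩, c⟩, _⟩
        exact ⟨⟨a, b⟩, c, by omega⟩
    rw [e]
    calc _ ≤ ∑ d ∈ Finset.Ioo 0 N, (2 / x) * ((d : ℝ) * √d)⁻¹ := by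
          apply Finset.sum_le_sum
          intro d hd
          have hd0 : 0 < d := (Finset.mem_Ioo.1 hd).1
          have hd' : (0 : ℝ) < d := by exact_mod_cast hd0
          rw [← Finset.mul_sum]
          calc _ ≤ (√(d : ℝ))⁻¹ * (2 / (d * (m + 1))) := by
                gcongr
                exact aux_tail m N d hd0
            _ ≤ (√(d : ℝ))⁻¹ * (2 / (d * x)) := by gcongr
            _ = _ := by field_simp
      _ = (2 / x) * ∑ d ∈ Finset.Ioo 0 N, ((d : ℝ) * √d)⁻¹ := by rw [Finset.mul_sum]
      _ ≤ (2 / x) * K := by gcongr; exact hKs _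
      _ = _ := by ring
  have h4 : ((S.filter (fun n => ¬ n ≤ m)).card : ℝ) ≤ 8 * K ^ 2 * x := by
    calc ((S.filter (fun n => ¬ n ≤ m)).card : ℝ) = ∑ n ∈ S.filter (fun n => ¬ n ≤ m), (1 : ℝ) := by simp
      _ ≤ ∑ n ∈ S.filter (fun n => ¬ n ≤ m),
          4 * K * x ^ 2 * (∑ d ∈ n.divisors, (√(d : ℝ))⁻¹ * ((n : ℝ) ^ 2)⁻¹) :=
        Finset.sum_le_sum fun n hn => h2 n (Finset.mem_filter.1 hn).1
      _ ≤ ∑ n ∈ Finset.Ioo m N,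
          4 * K * x ^ 2 * (∑ d ∈ n.divisors, (√(d : ℝ))⁻¹ * ((n : ℝ) ^ 2)⁻¹) := by
        apply Finset.sum_le_sum_of_subset_of_nonneg hsub
        intros
        apply mul_nonneg (by positivity)
        exact Finset.sum_nonneg fun _ _ => by positivity
      _ ≤ 4 * K * x ^ 2 * (2 * K / x) := by
        rw [← Finset.mul_sum]
        gcongr
      _ = _ := by field_simp; ring
  have h5 : (S.card : ℝ) = (S.filter (fun n => n ≤ m)).card + (S.filter (fun n => ¬ n ≤ m)).card := by
    exact_mod_cast hcard.symm
  have h6 : ((S.filter (fun n => n ≤ m)).card : ℝ) ≤ m := by exact_mod_cast h1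
  rw [h5]
  linarith

lemma aux_lcm : ∃ C : ℝ, 0 < C ∧ ∀ (D : ℕ) (S : Finset ℕ), 3 ≤ D → (∀ n ∈ S, 0 < n) →
    ∑ n ∈ S, n.totient ≤ D →
    ((S.lcm id : ℕ) : ℝ) ≤ Real.exp (C * Real.sqrt D * Real.log D *
              Real.sqrt (Real.log (Real.log D))) := by
  obtain ⟨C, hC, hCs⟩ := aux_count
  have hl3 : 1 < Real.log 3 := by
    rw [Real.lt_log_iff_exp_lt (by norm_num)]
    linarith [Real.exp_one_lt_d9]
  have hll3 : 0 < Real.log (Real.log 3) := Real.log_pos hl3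
  have hs3 : 0 < √(Real.log (Real.log 3)) := Real.sqrt_pos.2 hll3
  refine ⟨(C + 1) * 5 / √(Real.log (Real.log 3)), by positivity, fun D S hD hS hsum => ?_⟩
  have hD' : (3 : ℝ) ≤ D := by exact_mod_cast hD
  have hsD : 1 ≤ √(D : ℝ) := Real.one_le_sqrt.2 (by linarith)
  have hss : √(D : ℝ) * √D = D := Real.mul_self_sqrt (by positivity)
  have hk : (S.card : ℝ) ≤ (C + 1) * √D := by
    have hcard := Finset.card_filter_add_card_filter_not (s := S) (fun n => (n.totient : ℝ) ≤ √D)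
    have h1 := hCs (√D) (S.filter (fun n => (n.totient : ℝ) ≤ √D)) hsD (by
      intro n hn
      rw [Finset.mem_filter] at hn
      exact ⟨hS n hn.1, hn.2⟩)
    have h2 : ((S.filter (fun n => ¬ (n.totient : ℝ) ≤ √D)).card : ℝ) * √D ≤ D := by
      calc _ = ∑ n ∈ S.filter (fun n => ¬ (n.totient : ℝ) ≤ √D), √(D : ℝ) := by simp
        _ ≤ ∑ n ∈ S.filter (fun n => ¬ (n.totient : ℝ) ≤ √D), (n.totient : ℝ) := by
          apply Finset.sum_le_sum
          intro n hn
          rw [Finset.mem_filter] at hn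
          linarith [hn.2]
        _ ≤ ∑ n ∈ S, (n.totient : ℝ) :=
          Finset.sum_le_sum_of_subset_of_nonneg (Finset.filter_subset _ _) (by intros; positivity)
        _ ≤ D := by exact_mod_cast hsum
    have h3 : ((S.filter (fun n => ¬ (n.totient : ℝ) ≤ √D)).card : ℝ) ≤ √D := by
      by_contra h
      rw [not_le] at h
      nlinarith
    have h5 : (S.card : ℝ) = (S.filter (fun n => (n.totient : ℝ) ≤ √D)).card +
        (S.filter (fun n => ¬ (n.totient : ℝ) ≤ √D)).card := by
      exact_mod_cast hcard.symm
    rw [h5]; linarith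
  have hprod : ((S.lcm id : ℕ) : ℝ) ≤ (16 * (D : ℝ) ^ 2) ^ S.card := by
    have h1 : S.lcm id ≤ ∏ n ∈ S, n :=
      Nat.le_of_dvd (Finset.prod_pos hS) (Finset.lcm_dvd fun n hn => Finset.dvd_prod_of_mem _ hn)
    calc ((S.lcm id : ℕ) : ℝ) ≤ ((∏ n ∈ S, n : ℕ) : ℝ) := by exact_mod_cast h1
      _ = ∏ n ∈ S, (n : ℝ) := by push_cast; rfl
      _ ≤ ∏ n ∈ S, (16 * (D : ℝ) ^ 2) := by
        apply Finset.prod_le_prod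
        · intros; positivity
        · intro n hn
          refine (aux_sq n (hS n hn)).trans ?_
          have : (n.totient : ℝ) ≤ D := by
            exact_mod_cast (Finset.single_le_sum (f := Nat.totient) (fun _ _ => Nat.zero_le _) hn).trans hsum
          gcongr
      _ = _ := by simp
  have hlD : Real.log 3 ≤ Real.log D := Real.log_le_log (by norm_num) hD'
  have hlog : Real.log (16 * (D : ℝ) ^ 2) ≤ 5 * Real.log D := by
    have : 16 * (D : ℝ) ^ 2 ≤ (D : ℝ) ^ 5 := by
      have : (27 : ℝ) ≤ (D : ℝ) ^ 3 := by
        calc (27 : ℝ) = 3 ^ 3 := by norm_num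
          _ ≤ _ := by gcongr
      nlinarith [sq_nonneg (D : ℝ)]
    calc _ ≤ Real.log ((D : ℝ) ^ 5) := Real.log_le_log (by positivity) this
      _ = _ := by rw [Real.log_pow]; norm_num
  have hsl : √(Real.log (Real.log 3)) ≤ √(Real.log (Real.log D)) :=
    Real.sqrt_le_sqrt (Real.log_le_log (by linarith) hlD)
  refine hprod.trans ?_
  rw [← Real.exp_log (show (0 : ℝ) < (16 * (D : ℝ) ^ 2) ^ S.card by positivity), Real.log_pow]
  apply Real.exp_le_exp.2
  have hlD0 : 0 ≤ Real.log D := by linarith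
  calc (S.card : ℝ) * Real.log (16 * (D : ℝ) ^ 2) ≤ ((C + 1) * √D) * (5 * Real.log D) := by
        gcongr
        exact Real.log_nonneg (by nlinarith)
    _ = (C + 1) * 5 / √(Real.log (Real.log 3)) * √D * Real.log D * √(Real.log (Real.log 3)) := by
      field_simp
    _ ≤ _ := by gcongr

lemma aux_step (D : ℕ) (A : Finset ℤ) (hA : ∀ a ∈ A, 0 ≤ a ∧ a ≤ (D : ℤ)) (hne : A.Nonempty)
    (h : ℤ → ℚ) (hh : ∀ n, ∑ a ∈ A, h (n + a) = 1) (i j : ℤ)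
    (hij : ∀ k : ℤ, 0 ≤ k → k ≤ D → h (i + k) = h (j + k)) :
    (∀ k : ℤ, 0 ≤ k → k ≤ D → h (i + 1 + k) = h (j + 1 + k)) ∧
    (∀ k : ℤ, 0 ≤ k → k ≤ D → h (i - 1 + k) = h (j - 1 + k)) := by
  constructor
  · intro k hk hkD
    rcases lt_or_eq_of_le hkD with hlt | rfl
    · have := hij (k + 1) (by omega) (by omega)
      rw [show i + 1 + k = i + (k + 1) by ring, show j + 1 + k = j + (k + 1) by ring, this]
    · set m := A.max' hne with hm
      have hmA : m ∈ A := A.max'_mem hne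
      have h1 := hh (i + 1 + D - m)
      have h2 := hh (j + 1 + D - m)
      rw [← Finset.add_sum_erase _ _ hmA] at h1 h2
      have h3 : ∑ a ∈ A.erase m, h (i + 1 + D - m + a) = ∑ a ∈ A.erase m, h (j + 1 + D - m + a) := by
        apply Finset.sum_congr rfl
        intro a ha
        rw [Finset.mem_erase] at ha
        have ha1 := A.le_max' a ha.2
        have ha2 := hA a ha.2
        have ha3 := hA m hmA
        have := hij (1 + D - m + a) (by omega) (by omega)
        rw [show i + 1 + D - m + a = i + (1 + D - m + a) by ring,
          show j + 1 + D - m + a = j + (1 + D - m + a) by ring, this]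
      rw [h3] at h1
      simp only [sub_add_cancel] at h1 h2
      linarith
  · intro k hk hkD
    rcases lt_or_eq_of_le hk with hlt | rfl
    · have := hij (k - 1) (by omega) (by omega)
      rw [show i - 1 + k = i + (k - 1) by ring, show j - 1 + k = j + (k - 1) by ring, this]
    · set m := A.min' hne with hm
      have hmA : m ∈ A := A.min'_mem hne
      have h1 := hh (i - 1 - m)
      have h2 := hh (j - 1 - m)
      rw [← Finset.add_sum_erase _ _ hmA] at h1 h2
      have h3 : ∑ a ∈ A.erase m, h (i - 1 - m + a) = ∑ a ∈ A.erase m, h (j - 1 - m + a) := by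
        apply Finset.sum_congr rfl
        intro a ha
        rw [Finset.mem_erase] at ha
        have ha1 := A.min'_le a ha.2
        have ha2 := hA a ha.2
        have ha3 := hA m hmA
        have := hij (-1 - m + a) (by omega) (by omega)
        rw [show i - 1 - m + a = i + (-1 - m + a) by ring,
          show j - 1 - m + a = j + (-1 - m + a) by ring, this]
      rw [h3] at h1
      simp only [sub_add_cancel, add_zero] at h1 h2 ⊢
      linarith

lemma aux_period (D : ℕ) (A : Finset ℤ) (hA : ∀ a ∈ A, 0 ≤ a ∧ a ≤ (D : ℤ)) (hne : A.Nonempty)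
    (h : ℤ → ℚ) (hh : ∀ n, ∑ a ∈ A, h (n + a) = 1) (h01 : ∀ n, h n = 0 ∨ h n = 1) :
    ∃ T : ℕ, 0 < T ∧ ∀ n, h (n + T) = h n := by
  obtain ⟨i, j, hne', hw⟩ := Finite.exists_ne_map_eq_of_infinite
    (fun (n : ℤ) (k : Fin (D + 1)) => (h (n + (k : ℕ)) = 1 : Prop))
  wlog hlt : i < j generalizing i j
  · exact this j i hne'.symm hw.symm (by omega)
  have hij : ∀ k : ℤ, 0 ≤ k → k ≤ D → h (i + k) = h (j + k) := by
    intro k hk hkD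
    have := congrFun hw ⟨k.toNat, by omega⟩
    simp only [Int.toNat_of_nonneg hk] at this
    rcases h01 (i + k) with h1 | h1 <;> rcases h01 (j + k) with h2 | h2 <;> simp_all
  have hall : ∀ m : ℤ, ∀ k : ℤ, 0 ≤ k → k ≤ D → h (i + m + k) = h (j + m + k) := by
    intro m
    induction m using Int.induction_on with
    | zero => simpa using hij
    | succ m ih =>
      have := (aux_step D A hA hne h hh _ _ ih).1
      simpa only [add_assoc] using this
    | pred m ih =>
      have := (aux_step D A hA hne h hh _ _ ih).2
      simpa only [add_sub_assoc] using this
  refine ⟨(j - i).toNat, by omega, fun n => ?_⟩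
  have := hall (n - i) 0 le_rfl (by omega)
  rw [Int.toNat_of_nonneg (by omega)]
  rw [show n + (j - i) = j + (n - i) + 0 by ring, ← this]
  congr 1; ring

open Polynomial in
lemma aux_alg (D : ℕ) (A : Finset ℤ) (hA : ∀ a ∈ A, 0 ≤ a ∧ a ≤ (D : ℤ)) (hne : A.Nonempty)
    (h : ℤ → ℚ) (hh : ∀ n, ∑ a ∈ A, h (n + a) = 1) (T : ℕ) (hT : 0 < T)
    (hper : ∀ n, h (n + T) = h n) :
    ∃ S : Finset ℕ, (∀ n ∈ S, 0 < n) ∧ ∑ n ∈ S, n.totient ≤ D ∧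
      ∀ n, h (n + (S.lcm id : ℕ)) = h n := by
  classical
  set P : ℚ[X] := ∑ a ∈ A, X ^ a.toNat with hP
  set E : Module.End ℚ (ℤ → ℚ) := LinearMap.funLeft ℚ ℚ (fun n : ℤ => n + 1) with hE
  have hEpow : ∀ (k : ℕ) (f : ℤ → ℚ) (n : ℤ), (E ^ k) f n = f (n + k) := by
    intro k
    induction k with
    | zero => intro f n; simp
    | succ k ih =>
      intro f n
      rw [pow_succ, Module.End.mul_apply, ih]
      simp only [hE, LinearMap.funLeft_apply]
      push_cast
      rw [add_assoc]
  have hPh : ∀ n, (aeval E P) h n = 1 := by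
    intro n
    simp only [hP, map_sum, map_pow, aeval_X, LinearMap.sum_apply, Finset.sum_apply, hEpow]
    rw [← hh n]
    apply Finset.sum_congr rfl
    intro a ha
    rw [Int.toNat_of_nonneg (hA a ha).1]
  have hP0 : P ≠ 0 := by
    intro h0
    have := hPh 0
    rw [h0] at this
    simp at this
  have hdeg : P.natDegree ≤ D := by
    apply natDegree_sum_le_of_forall_le
    intro a ha
    have := hA a ha
    rw [natDegree_X_pow]; omega
  have hann1 : (aeval E ((X - 1) * P)) h = 0 := by
    rw [map_mul, Module.End.mul_apply]
    have : (aeval E P) h = fun _ => 1 := funext hPh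
    rw [this]
    funext n
    simp [hE, LinearMap.funLeft_apply]
  have hann2 : (aeval E (X ^ T - 1 : ℚ[X])) h = 0 := by
    funext n
    simp [hEpow, hper]
  set S := T.divisors.filter (fun s => cyclotomic s ℚ ∣ P) with hS
  have hSpos : ∀ n ∈ S, 0 < n := fun n hn => Nat.pos_of_mem_divisors (Finset.mem_filter.1 hn).1
  have hpair : ∀ U : Finset ℕ, (U : Set ℕ).Pairwise (Function.onFun IsCoprime fun s => cyclotomic s ℚ) :=
    fun U a _ b _ hab => cyclotomic.isCoprime_rat hab
  refine ⟨S, hSpos, ?_, ?_⟩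
  · have hdvd : ∏ s ∈ S, cyclotomic s ℚ ∣ P :=
      Finset.prod_dvd_of_coprime (hpair S) (fun s hs => (Finset.mem_filter.1 hs).2)
    have := natDegree_le_of_dvd hdvd hP0
    rw [natDegree_prod _ _ (fun s _ => cyclotomic_ne_zero s ℚ)] at this
    simp only [natDegree_cyclotomic] at this
    exact this.trans hdeg
  · set L := S.lcm id with hL
    set G := T.divisors.filter (fun s => s = 1 ∨ cyclotomic s ℚ ∣ P) with hG
    set G' := T.divisors.filter (fun s => ¬ (s = 1 ∨ cyclotomic s ℚ ∣ P)) with hG'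
    have hprod : (∏ s ∈ G, cyclotomic s ℚ) * ∏ s ∈ G', cyclotomic s ℚ = X ^ T - 1 := by
      rw [Finset.prod_filter_mul_prod_filter_not, prod_cyclotomic_eq_X_pow_sub_one hT]
    have hGL : ∏ s ∈ G, cyclotomic s ℚ ∣ X ^ L - 1 := by
      apply Finset.prod_dvd_of_coprime (hpair G)
      intro s hs
      rw [hG, Finset.mem_filter] at hs
      have hsL : s ∣ L := by
        rcases hs.2 with rfl | h2
        · exact one_dvd _
        · exact Finset.dvd_lcm (f := id) (Finset.mem_filter.2 ⟨hs.1, h2⟩)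
      exact (cyclotomic.dvd_X_pow_sub_one s ℚ).trans (by
        obtain ⟨q, hq⟩ := hsL
        rw [hq, pow_mul]
        simpa using sub_dvd_pow_sub_pow (X ^ s : ℚ[X]) 1 q)
    have hcop : IsCoprime (∏ s ∈ G', cyclotomic s ℚ) ((X - 1) * P) := by
      apply IsCoprime.prod_left
      intro s hs
      rw [hG', Finset.mem_filter, not_or] at hs
      apply IsCoprime.mul_right
      · have := cyclotomic.isCoprime_rat hs.2.1
        rwa [cyclotomic_one] at this
      · exact ((cyclotomic.irreducible_rat (Nat.pos_of_mem_divisors hs.1)).coprime_iff_not_dvd).2 hs.2.2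
    obtain ⟨u, v, huv⟩ := hcop
    obtain ⟨w, hw⟩ := hGL
    have key : (X ^ L - 1 : ℚ[X]) = (w * u) * (X ^ T - 1) +
        (w * (∏ s ∈ G, cyclotomic s ℚ) * v) * ((X - 1) * P) := by
      rw [hw, ← hprod]
      linear_combination (-(∏ s ∈ G, cyclotomic s ℚ) * w) * huv
    have hfin : (aeval E (X ^ L - 1 : ℚ[X])) h = 0 := by
      rw [key, map_add, map_mul, map_mul (aeval E) (w * _ * v), LinearMap.add_apply,
        Module.End.mul_apply, Module.End.mul_apply, hann1, hann2]
      simp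
    intro n
    have := congrFun hfin n
    simp [hEpow] at this
    linarith

theorem stmt_7 :
    ∃ C : ℝ, 0 < C ∧
      ∀ D : ℕ, 3 ≤ D → ∀ A : Finset ℤ, (∀ a ∈ A, 0 ≤ a ∧ a ≤ (D : ℤ)) →
        ∀ Λ : Set ℤ,
          (∀ x : ℤ, ∃! p : ℤ × ℤ, p.1 ∈ A ∧ p.2 ∈ Λ ∧ p.1 + p.2 = x) →
          ∃ t : ℤ, 1 ≤ t ∧
            (t : ℝ) ≤ Real.exp (C * Real.sqrt D * Real.log D *
              Real.sqrt (Real.log (Real.log D))) ∧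
            (fun l => l + t) '' Λ = Λ := by
  classical
  obtain ⟨C, hC, hmain⟩ := aux_lcm
  refine ⟨C, hC, fun D hD A hA Λ hΛ => ?_⟩
  have hne : A.Nonempty := by
    obtain ⟨p, hp, _⟩ := hΛ 0
    exact ⟨p.1, hp.1⟩
  set h : ℤ → ℚ := fun n => if -n ∈ Λ then 1 else 0 with hh
  have h01 : ∀ n, h n = 0 ∨ h n = 1 := by
    intro n
    by_cases hn : -n ∈ Λ <;> simp [hh, hn]
  have hsum : ∀ n, ∑ a ∈ A, h (n + a) = 1 := by
    intro n
    obtain ⟨p, ⟨hp1, hp2, hp3⟩, hu⟩ := hΛ (-n)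
    rw [Finset.sum_eq_single p.1]
    · have : -(n + p.1) = p.2 := by linarith
      simp [hh, this, hp2]
    · intro b hb hbp
      have : ¬ (-(n + b) ∈ Λ) := by
        intro hmem
        have := hu (b, -(n + b)) ⟨hb, hmem, by ring⟩
        exact hbp (by rw [← this])
      simp only [hh, if_neg this]
    · intro hn; exact absurd hp1 hn
  obtain ⟨T, hT, hper⟩ := aux_period D A hA hne h hsum h01
  obtain ⟨S, hS, htot, hL⟩ := aux_alg D A hA hne h hsum T hT hper
  have hLpos : 0 < S.lcm id := by
    rw [Nat.pos_iff_ne_zero, Ne, Finset.lcm_eq_zero_iff]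
    rintro ⟨n, hn, h0⟩
    have := hS n hn
    simp at h0
    omega
  have hiff : ∀ n : ℤ, -(n + (S.lcm id : ℕ)) ∈ Λ ↔ -n ∈ Λ := by
    intro n
    have := hL n
    simp only [hh] at this
    by_cases h1 : -(n + (S.lcm id : ℕ)) ∈ Λ <;> by_cases h2 : -n ∈ Λ <;>
      simp only [h1, h2, if_true, if_false] at this ⊢ <;> norm_num at this
  refine ⟨(S.lcm id : ℕ), by exact_mod_cast hLpos, ?_, ?_⟩
  · have := hmain D S hD hS htot
    exact_mod_cast this
  · ext x
    simp only [Set.mem_image]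
    constructor
    · rintro ⟨l, hl, rfl⟩
      have := hiff (-(l + (S.lcm id : ℕ)))
      rw [neg_neg] at this
      apply this.1
      convert hl using 1
      ring
    · intro hx
      refine ⟨x - (S.lcm id : ℕ), ?_, by ring⟩
      have := hiff (-x)
      rw [neg_neg] at this
      convert this.2 hx using 1
      ring
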